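/- For each p < 1/2 let β₁(p) = (1−2p)/(2−2p), which lies in (0,1/2]. Then for every β ≤ β₁(p), every ε > 0 and every initial configuration S₀ ∈ 𝒟∖{𝒟₀}, the relaxation time of the discrete-time exclusion-voter chain satisfies E_{β,p}[τ^{1+ε} | ξ₀ = S₀] = ∞. -/

import Mathlib

open MeasureTheory Filter
open scoped ENNReal NNReal

namespace EV

/-- A configuration of the exclusion-voter model is the finite hybrid-zone word
(`false` = 0, `true` = 1); the full two-sided configuration is `1^∞ w 0^∞`. -/
abbrev Word := List Bool

/-- Canonical (normalized) words: empty (the ground state `𝒟₀`) or starting with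
a `0` and ending with a `1`; these are in bijection with the configuration space `𝒟`. -/
def IsConfig (w : Word) : Prop :=
  w = [] ∨ (w.head? = some false ∧ w.getLast? = some true)

/-- The ground-state Heaviside configuration `𝒟₀ = …111000…`. -/
def groundState : Word := []

/-- Pad a word with one boundary symbol of the adjacent infinite block on each side. -/
def pad (w : Word) : Word := true :: (w ++ [false])

/-- Normalize: strip leading `1`s (they merge into the left infinite block of `1`s)
and trailing `0`s (they merge into the right infinite block of `0`s). -/
def strip (w : Word) : Word :=
  ((w.dropWhile (· = true)).reverse.dropWhile (· = false)).reverse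

def setPair (w : Word) (i : ℕ) (a b : Bool) : Word := (w.set i a).set (i + 1) b

def swapPair (w : Word) (i : ℕ) : Word :=
  setPair w i (w.getD (i + 1) true) (w.getD i true)

/-- Indices of the unlike adjacent pairs (`01` or `10`), read off the padded word. -/
def unlike (w : Word) : List ℕ :=
  (List.range (w.length + 1)).filter
    (fun i => (pad w).getD i true ≠ (pad w).getD (i + 1) true)

/-- One-step transition kernel of the discrete-time exclusion-voter chain with mixing
parameter `β` and exclusion parameter `p`: an unlike adjacent pair is chosen uniformly
at random; with probability `β` a voter move flips the pair to `00` or `11` (each with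
probability `1/2`); with probability `1-β` an exclusion move swaps a `01` with
probability `p` and a `10` with probability `1-p` (otherwise no change). -/
noncomputable def P (β p : ℝ) (w w' : Word) : ℝ :=
  ((unlike w).map (fun i =>
    let a := (pad w).getD i true
    let swapProb := if a then 1 - p else p
    ((unlike w).length : ℝ)⁻¹ *
      (β * (1 / 2) * (if strip (setPair (pad w) i false false) = w' then 1 else 0)
       + β * (1 / 2) * (if strip (setPair (pad w) i true true) = w' then 1 else 0)
       + (1 - β) * swapProb * (if strip (swapPair (pad w) i) = w' then 1 else 0)
       + (1 - β) * (1 - swapProb) * (if w = w' then 1 else 0)))).sum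

/-- `n`-step transition probabilities. -/
noncomputable def Pn (β p : ℝ) : ℕ → Word → Word → ℝ
  | 0 => fun w w' => if w = w' then 1 else 0
  | n + 1 => fun w w' => ∑' z : Word, Pn β p n w z * P β p z w'

/-- `w'` is accessible from `w`: some `n`-step transition probability is positive. -/
def Accessible (β p : ℝ) (w w' : Word) : Prop :=
  ∃ n : ℕ, 0 < n ∧ 0 < Pn β p n w w'

/-- Two states communicate: each is accessible from the other. -/
def Communicate (β p : ℝ) (w w' : Word) : Prop :=
  Accessible β p w w' ∧ Accessible β p w' w

instance : MeasurableSpace Word := ⊤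

/-- `ξ` is (a realization of) the discrete-time exclusion-voter Markov chain with
parameters `(β, p)` under the probability measure `μ`. -/
def IsEVChain (β p : ℝ) {Ω : Type*} [MeasurableSpace Ω] (μ : Measure Ω)
    (ξ : ℕ → Ω → Word) : Prop :=
  (∀ t, Measurable (ξ t)) ∧
  ∀ (t : ℕ) (path : ℕ → Word),
    μ {ω | ∀ i ≤ t + 1, ξ i ω = path i}
      = μ {ω | ∀ i ≤ t, ξ i ω = path i} * ENNReal.ofReal (P β p (path t) (path (t + 1)))

/-- The relaxation time `τ = min {t ∈ ℕ, t ≥ 1 : ξ_t = 𝒟₀}` (`∞` if there is no such `t`). -/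
noncomputable def relaxTime {Ω : Type*} (ξ : ℕ → Ω → Word) (ω : Ω) : ℝ≥0∞ :=
  sInf {r : ℝ≥0∞ | ∃ t : ℕ, 0 < t ∧ ξ t ω = groundState ∧ r = (t : ℝ≥0∞)}

/-- The size `|S|` of the hybrid zone. -/
def hz (w : Word) : ℕ := w.length

/-- The number of blocks `N(S)`: the number of (finite) `1`-blocks of the hybrid zone. -/
def nb (w : Word) : ℕ :=
  ((Finset.range w.length).filter
    (fun b => w.getD b false = true ∧ (b = 0 ∨ w.getD (b - 1) true = false))).card

/-- Number of `0`s among the first `c` positions of the hybrid zone. -/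
def z0 (w : Word) (c : ℕ) : ℕ :=
  ((Finset.range c).filter (fun a => w.getD a true = false)).card

/-- Number of `1`s of the hybrid zone at positions `≥ c`. -/
def o1 (w : Word) (c : ℕ) : ℕ :=
  ((Finset.Ico c w.length).filter (fun b => w.getD b false = true)).card

/-- `f₁(S) = Σᵢ mᵢ Rᵢ = Σᵢ nᵢ Tᵢ`: each `1` contributes the number of `0`s to its left. -/
def f1 (w : Word) : ℕ :=
  ∑ b ∈ (Finset.range w.length).filter (fun b => w.getD b false = true), z0 w b

/-- `f₂(S) = (1/2)(Σᵢ mᵢ Rᵢ² + Σᵢ nᵢ Tᵢ²)`: each `1` contributes the squared number of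
`0`s to its left, each `0` the squared number of `1`s to its right. -/
noncomputable def f2 (w : Word) : ℝ :=
  (1 / 2) *
    ((∑ b ∈ (Finset.range w.length).filter (fun b => w.getD b false = true),
        ((z0 w b : ℝ)) ^ 2)
     + (∑ a ∈ (Finset.range w.length).filter (fun a => w.getD a true = false),
        ((o1 w (a + 1) : ℝ)) ^ 2))

/-- `g(S) = max_{1 ≤ k ≤ N} R_k T_k`: the maximum over the `01`-corners of
(number of `0`s up to the corner) × (number of `1`s after the corner). -/
def gfun (w : Word) : ℕ :=
  ((Finset.range w.length).filter
    (fun a => w.getD a true = false ∧ w.getD (a + 1) false = true)).sup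
    (fun a => z0 w (a + 1) * o1 w (a + 1))

/-- `φ₁(S) = Σᵢ Σ_{j=R_{i-1}+1}^{R_i} Σ_{k=1}^{T_i} 1/(j+k)`: the `j`-th `0` (at position `a`,
so `j = z0 w (a+1)`) contributes `Σ_{k=1}^{T} 1/(j+k)` with `T` the number of `1`s to its right. -/
noncomputable def phi1 (w : Word) : ℝ :=
  ∑ a ∈ (Finset.range w.length).filter (fun a => w.getD a true = false),
    ∑ k ∈ Finset.Icc 1 (o1 w (a + 1)), (1 : ℝ) / ((z0 w (a + 1) : ℝ) + (k : ℝ))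


/-- The number of inversions (a `0` somewhere to the left of a `1`) of a word. -/
def inv : Word → ℕ
  | [] => 0
  | true :: v => inv v
  | false :: v => inv v + v.count true

/-- The inversions formed by the `i`-th `0` from the left and the `j`-th `1` from the right,
counted with weight `2 * (i + j - 1)`. -/
def winv : Word → ℕ
  | [] => 0
  | true :: v => winv v
  | false :: v => winv v + 2 * inv v + v.count true * (v.count true + 1)

lemma inv_append (u v : Word) :
    inv (u ++ v) = inv u + inv v + u.count false * v.count true := by
  induction u with
  | nil => simp [inv]
  | cons x u ih =>
    cases x <;> simp [inv, ih]; ring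

lemma winv_append (u v : Word) :
    winv (u ++ v) = winv u + winv v + 2 * v.count true * inv u + 2 * u.count false * inv v
      + u.count false * v.count true * (u.count false + v.count true) := by
  induction u with
  | nil => simp [inv, winv]
  | cons x u ih =>
    cases x <;> simp [inv, winv, ih, inv_append]; ring

/-- A functional of words that ignores leading `1`s and trailing `0`s is invariant
under `strip`. -/
lemma apply_strip {α : Type*} (F : Word → α) (hl : ∀ v, F (true :: v) = F v)
    (hr : ∀ v, F (v ++ [false]) = F v) (v : Word) : F (strip v) = F v := by
  have h1 : ∀ v : Word, F (v.dropWhile (· = true)) = F v := by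
    intro v
    induction v with
    | nil => rfl
    | cons x v ih => cases x <;> simp_all
  have h2 : ∀ v : Word, F ((v.reverse.dropWhile (· = false)).reverse) = F v := by
    intro v
    induction v using List.reverseRecOn with
    | nil => rfl
    | append_singleton v x ih => cases x <;> simp_all
  rw [strip, h2, h1]

lemma inv_strip (v : Word) : inv (strip v) = inv v :=
  apply_strip inv (fun _ => rfl) (fun v => by simp [inv_append, inv]) v

lemma winv_strip (v : Word) : winv (strip v) = winv v :=
  apply_strip winv (fun _ => rfl) (fun v => by simp [winv_append, inv, winv]) v

lemma inv_pad (w : Word) : inv (pad w) = inv w := by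
  simp [pad, inv, inv_append]

lemma winv_pad (w : Word) : winv (pad w) = winv w := by
  simp [pad, inv, winv, winv_append]

lemma length_strip_le (v : Word) : (strip v).length ≤ v.length := by
  have h1 := (List.dropWhile_suffix (l := v) (fun b => decide (b = true))).length_le
  have h2 := (List.dropWhile_suffix
    (l := (v.dropWhile (· = true)).reverse) (fun b => decide (b = false))).length_le
  simp only [strip, List.length_reverse] at *
  omega

lemma inv_le_length_sq (v : Word) : inv v ≤ v.length ^ 2 := by
  induction v with
  | nil => simp [inv]
  | cons x v ih =>
    have := List.count_le_length (a := true) (l := v)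
    cases x <;> simp [inv] <;> nlinarith

/-- Many inversions force a large weighted number of inversions. -/
lemma two_mul_inv_le (v : Word) (r : ℕ) : 2 * r * inv v ≤ winv v + 2 * r ^ 3 := by
  induction v generalizing r with
  | nil => simp [inv]
  | cons x v ih =>
    cases x with
    | true => simpa [inv, winv] using ih r
    | false =>
      rcases r with _ | r
      · simp
      · have h := ih r
        simp only [inv, winv]
        generalize List.count true v = o at *
        have h2 : 2 * (r + 1) * o ≤ o * (o + 1) + (r + 1) * r := by
          rcases le_or_gt o r with hor | hor
          · obtain ⟨d, rfl⟩ := Nat.exists_eq_add_of_le hor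
            nlinarith [Nat.zero_le (d * d)]
          · obtain ⟨d, rfl⟩ := Nat.exists_eq_add_of_lt hor
            nlinarith [Nat.zero_le (d * d)]
        nlinarith [Nat.zero_le (r ^ 2)]

lemma inv_pos {w : Word} (hw : IsConfig w) (hne : w ≠ groundState) : 0 < inv w := by
  rcases hw with h | ⟨h1, h2⟩
  · exact absurd h hne
  · cases w with
    | nil => simp at h1
    | cons x v =>
      simp only [List.head?_cons, Option.some.injEq] at h1
      subst h1
      have hm : true ∈ v := by
        have := List.mem_of_getLast? h2
        simpa using this
      have := List.count_pos_iff.mpr hm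
      simp only [inv]
      omega

/-- The positions of the unlike adjacent pairs, as a finite set. -/
def unlikeSet (w : Word) : Finset ℕ :=
  (Finset.range (w.length + 1)).filter
    (fun i => (pad w).getD i true ≠ (pad w).getD (i + 1) true)

lemma toFinset_unlike (w : Word) : (unlike w).toFinset = unlikeSet w := by
  ext i
  simp [unlike, unlikeSet]

lemma nodup_unlike (w : Word) : (unlike w).Nodup :=
  List.nodup_range.filter _

lemma length_unlike (w : Word) : (unlike w).length = (unlikeSet w).card := by
  rw [← toFinset_unlike, List.toFinset_card_of_nodup (nodup_unlike w)]

lemma sum_unlike (w : Word) (f : ℕ → ℝ) :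
    ((unlike w).map f).sum = ∑ i ∈ unlikeSet w, f i := by
  rw [← toFinset_unlike, List.sum_toFinset f (nodup_unlike w)]

/-- The contribution of the pair at position `i` to the conditional expectation of `h`
after one step. -/
noncomputable def pairMean (β p : ℝ) (h : Word → ℝ) (w : Word) (i : ℕ) : ℝ :=
  let swapProb := if (pad w).getD i true then 1 - p else p
  β * (1 / 2) * h (strip (setPair (pad w) i false false))
    + β * (1 / 2) * h (strip (setPair (pad w) i true true))
    + (1 - β) * swapProb * h (strip (swapPair (pad w) i))
    + (1 - β) * (1 - swapProb) * h w

/-- The conditional expectation of `h` after one step. -/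
noncomputable def stepMean (β p : ℝ) (h : Word → ℝ) (w : Word) : ℝ :=
  ((unlikeSet w).card : ℝ)⁻¹ * ∑ i ∈ unlikeSet w, pairMean β p h w i

lemma P_eq_sum (β p : ℝ) (w w' : Word) :
    P β p w w' = stepMean β p (fun x => if x = w' then 1 else 0) w := by
  rw [P, sum_unlike, stepMean, Finset.mul_sum]
  simp only [pairMean, length_unlike]

lemma length_setPair (w : Word) (i : ℕ) (a b : Bool) : (setPair w i a b).length = w.length := by
  simp [setPair]

lemma length_pad (w : Word) : (pad w).length = w.length + 2 := by simp [pad]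

lemma length_strip_setPair (w : Word) (i : ℕ) (a b : Bool) :
    (strip (setPair (pad w) i a b)).length ≤ w.length + 2 := by
  refine (length_strip_le _).trans ?_
  rw [length_setPair, length_pad]

lemma sum_P_mul (β p : ℝ) (h : Word → ℝ) (w : Word) (s : Finset Word)
    (hs : ∀ v : Word, v.length ≤ w.length + 2 → v ∈ s) :
    ∑ v ∈ s, P β p w v * h v = stepMean β p h w := by
  simp only [P_eq_sum, stepMean, mul_assoc, Finset.sum_mul, ← Finset.mul_sum]
  congr 1
  rw [Finset.sum_comm]
  refine Finset.sum_congr rfl fun i _ => ?_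
  have hw : w ∈ s := hs w (by omega)
  have h1 := fun a b => hs _ (length_strip_setPair w i a b)
  have h2 : strip (swapPair (pad w) i) ∈ s := h1 _ _
  simp [pairMean, add_mul, Finset.sum_add_distrib, mul_assoc, h1, h2, hw]

lemma P_nonneg {β p : ℝ} (hβ0 : 0 ≤ β) (hβ1 : β ≤ 1) (hp0 : 0 ≤ p) (hp1 : p ≤ 1)
    (w w' : Word) : 0 ≤ P β p w w' := by
  have h1 : 0 ≤ 1 - β := by linarith
  have h2 : 0 ≤ 1 - p := by linarith
  rw [P_eq_sum, stepMean]
  refine mul_nonneg (by positivity) (Finset.sum_nonneg fun i _ => ?_)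
  have h3 : ∀ x : Word, (0 : ℝ) ≤ if x = w' then 1 else 0 := fun x => by
    split_ifs <;> norm_num
  have h4 : 0 ≤ if (pad w).getD i true then 1 - p else p := by split_ifs <;> assumption
  have h5 : 0 ≤ 1 - if (pad w).getD i true then 1 - p else p := by split_ifs <;> linarith
  exact add_nonneg (add_nonneg (add_nonneg (mul_nonneg (by positivity) (h3 _))
    (mul_nonneg (by positivity) (h3 _))) (mul_nonneg (mul_nonneg h1 h4) (h3 _)))
    (mul_nonneg (mul_nonneg h1 h5) (h3 _))

lemma setPair_append (A B : Word) (a b x y : Bool) :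
    setPair (A ++ a :: b :: B) A.length x y = A ++ x :: y :: B := by
  simp [setPair]

/-- Around an unlike pair the padded word splits into a left part, the pair and a
right part. -/
lemma exists_split {w : Word} {i : ℕ} (hi : i ∈ unlikeSet w) :
    ∃ (A B : Word) (a : Bool), pad w = A ++ a :: (!a) :: B ∧ (pad w).getD i true = a ∧
      (pad w).getD (i + 1) true = !a ∧
      (∀ x y, setPair (pad w) i x y = A ++ x :: y :: B) ∧
      swapPair (pad w) i = A ++ (!a) :: a :: B := by
  simp only [unlikeSet, Finset.mem_filter, Finset.mem_range] at hi
  obtain ⟨hi, hne⟩ := hi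
  have hl := length_pad w
  have h0 : i < (pad w).length := by omega
  have h1 : i + 1 < (pad w).length := by omega
  set v := pad w with hv
  have hd : v = v.take i ++ v[i] :: v[i + 1] :: v.drop (i + 2) := by
    rw [List.getElem_cons_drop, List.getElem_cons_drop, List.take_append_drop]
  have ha : v.getD i true = v[i] := by simp [h0]
  have hb : v.getD (i + 1) true = v[i + 1] := by simp [h1]
  have hb' : v[i + 1] = !v[i] := by
    rw [ha, hb] at hne
    revert hne
    cases v[i] <;> cases v[i + 1] <;> simp
  have hset : ∀ x y, setPair v i x y = v.take i ++ x :: y :: v.drop (i + 2) := by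
    intro x y
    have hli : (v.take i).length = i := by simp; omega
    have := setPair_append (v.take i) (v.drop (i + 2)) v[i] v[i + 1] x y
    rwa [hli, ← hd] at this
  refine ⟨v.take i, v.drop (i + 2), v[i], ?_, ha, by rw [hb, hb'], hset, ?_⟩
  · rw [← hb']; exact hd
  · rw [swapPair, hset, ha, hb, hb']

lemma exists_of_P_ne_zero {β p : ℝ} {w w' : Word} (h : P β p w w' ≠ 0) :
    w' = w ∨ ∃ i ∈ unlikeSet w, w' = strip (setPair (pad w) i false false) ∨
      w' = strip (setPair (pad w) i true true) ∨ w' = strip (swapPair (pad w) i) := by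
  by_contra hcon
  push Not at hcon
  obtain ⟨h0, hcon⟩ := hcon
  apply h
  rw [P_eq_sum, stepMean, Finset.sum_eq_zero, mul_zero]
  intro i hi
  obtain ⟨h1, h2, h3⟩ := hcon i hi
  simp [pairMean, h0.symm, h1.symm, h2.symm, h3.symm]

/-- One step at most doubles the number of inversions, up to a unit. -/
lemma inv_le_of_P_ne_zero {β p : ℝ} {w w' : Word} (h : P β p w w' ≠ 0) :
    inv w' ≤ 2 * inv w + 1 := by
  rcases exists_of_P_ne_zero h with rfl | ⟨i, hi, hw⟩
  · omega
  obtain ⟨A, B, a, hpad, -, -, hset, hswap⟩ := exists_split hi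
  rw [hset, hset, hswap] at hw
  rw [← inv_pad w, hpad]
  generalize hz : A.count false = z
  generalize ho : B.count true = o
  rcases hw with rfl | rfl | rfl <;> rw [inv_strip] <;> cases a <;>
    simp [inv_append, inv, hz, ho] <;> nlinarith

/-- The `10` pairs outnumber the `01` pairs by one. -/
lemma sum_sign (w : Word) :
    ∑ i ∈ unlikeSet w, (if (pad w).getD i true then (1 : ℝ) else -1) = 1 := by
  set f : ℕ → ℝ := fun i => if (pad w).getD i true then 1 else 0 with hf
  have hsum : ∑ i ∈ unlikeSet w, (if (pad w).getD i true then (1 : ℝ) else -1)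
      = ∑ i ∈ Finset.range (w.length + 1), (f i - f (i + 1)) := by
    rw [unlikeSet, Finset.sum_filter]
    refine Finset.sum_congr rfl fun i _ => ?_
    simp only [hf]
    cases (pad w).getD i true <;> cases (pad w).getD (i + 1) true <;> simp
  rw [hsum, Finset.sum_range_sub']
  simp [hf, pad]

lemma card_unlikeSet_pos (w : Word) : 0 < (unlikeSet w).card := by
  rw [Finset.card_pos]
  by_contra h
  have := sum_sign w
  simp [Finset.not_nonempty_iff_eq_empty.mp h] at this

/-- The Lyapunov function: the number of inversions, with a correction at scale `s`. -/
noncomputable def lyap (s : ℝ) (w : Word) : ℝ :=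
  inv w - 3 / (2 * s) * winv w + 1 / (8 * s ^ 2) * (inv w : ℝ) ^ 2

/-- The loss of the Lyapunov function at scale `s` in one step from a word of length at most
`l`. -/
noncomputable def lyapLoss (β s : ℝ) (l : ℕ) : ℝ :=
  min (3 / s * (l + 2)) (8 + 18 / β)

lemma lyapLoss_nonneg {β s : ℝ} (hβ0 : 0 < β) (hs : 0 < s) (l : ℕ) : 0 ≤ lyapLoss β s l := by
  unfold lyapLoss
  positivity

/-- The drift of the weighted inversions at a `10` pair is compensated by the variance of the
inversions, as long as there are few inversions. -/
lemma drift_le_lyapLoss {β s r t : ℝ} {l : ℕ} (hβ0 : 0 < β) (hβ1 : β ≤ 1) (hs : 1 ≤ s)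
    (hl : r + t ≤ l) (hrt : r * t ≤ 4 * s ^ 2) :
    3 / (2 * s) * (2 * (r + t + 1)) - 1 / (8 * s ^ 2) * (β * (r - t) ^ 2) ≤ lyapLoss β s l := by
  have hs0 : 0 < s := by linarith
  have h1 : 3 / (2 * s) * (2 * (r + t + 1)) = 3 / s * (r + t + 1) := by field_simp
  refine le_min ?_ ?_
  · have h2 : 0 ≤ 1 / (8 * s ^ 2) * (β * (r - t) ^ 2) := by positivity
    have h3 : 3 / s * (r + t + 1) ≤ 3 / s * (l + 2) := by gcongr; linarith
    linarith
  · set y := (r + t) / s with hy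
    have h2 : 3 / s * (r + t + 1) = 3 * y + 3 / s := by rw [hy]; field_simp
    have h3 : 1 / (8 * s ^ 2) * (β * (r - t) ^ 2)
        = β * y ^ 2 / 8 - β / 2 * (r * t / s ^ 2) := by rw [hy]; field_simp; ring
    have h4 : r * t / s ^ 2 ≤ 4 := by rw [div_le_iff₀ (by positivity)]; exact hrt
    have h5 : β / 2 * (r * t / s ^ 2) ≤ β / 2 * 4 := by gcongr
    have h6 : 3 / s ≤ 3 := by rw [div_le_iff₀ hs0]; linarith
    have h7 : 18 / β - 3 * y + β * y ^ 2 / 8 = (12 - β * y) ^ 2 / (8 * β) := by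
      field_simp; ring
    have h8 : 0 ≤ (12 - β * y) ^ 2 / (8 * β) := by positivity
    linarith

lemma pairMean_lyap_ge {β p s : ℝ} (hβ0 : 0 < β) (hβ1 : β ≤ 1) (hp0 : 0 ≤ p) (hp1 : p ≤ 1)
    (hs : 1 ≤ s) {w : Word} (hw : (inv w : ℝ) < 4 * s ^ 2) {i : ℕ} (hi : i ∈ unlikeSet w) :
    lyap s w + (1 + 1 / (4 * s ^ 2) * inv w) *
        (if (pad w).getD i true then (1 - β) * (1 - p) else -((1 - β) * p + β))
      - lyapLoss β s w.length ≤ pairMean β p (lyap s) w i := by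
  have hs0 : 0 < s := by linarith
  obtain ⟨A, B, a, hpad, ha, -, hset, hswap⟩ := exists_split hi
  have hlen := length_pad w
  have hz := List.count_le_length (a := false) (l := A)
  have ho := List.count_le_length (a := true) (l := B)
  rw [hpad] at hlen
  simp only [List.length_append, List.length_cons] at hlen
  simp only [pairMean, lyap, hset, hswap, inv_strip, winv_strip, ha]
  rw [← inv_pad w] at hw
  rw [← inv_pad w, ← winv_pad w]
  rw [hpad] at hw ⊢
  have hloss := lyapLoss_nonneg hβ0 hs0 w.length
  have hx0 : 0 ≤ (1 - β) * (1 - p) := mul_nonneg (by linarith) (by linarith)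
  have hp' : 0 ≤ (1 - β) * p := mul_nonneg (by linarith) hp0
  have hν : 0 < 3 / (2 * s) := by positivity
  have hμ : 0 < 1 / (8 * s ^ 2) := by positivity
  have hμ' : 1 / (4 * s ^ 2) = 2 * (1 / (8 * s ^ 2)) := by field_simp; norm_num
  have hrt0 : (0 : ℝ) ≤ A.count false := by positivity
  have ht0 : (0 : ℝ) ≤ B.count true := by positivity
  have hl : (A.count false : ℝ) + B.count true ≤ w.length := by
    norm_cast
    omega
  have hiA : (0 : ℝ) ≤ inv A := by positivity
  have hiB : (0 : ℝ) ≤ inv B := by positivity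
  have hdrift := drift_le_lyapLoss (r := A.count false) (t := B.count true) hβ0 hβ1 hs hl
  rw [hμ']
  cases a
  · simp [inv_append, winv_append, inv, winv, -one_div, -mul_inv_rev] at hw ⊢
    generalize (A.count false : ℝ) = r at *
    generalize (B.count true : ℝ) = t at *
    generalize (inv A : ℝ) = f at *
    generalize (inv B : ℝ) = g at *
    generalize (winv A : ℝ) = u at *
    generalize (winv B : ℝ) = v at *
    generalize 3 / (2 * s) = ν at *
    generalize 1 / (8 * s ^ 2) = μ at *
    have h1 : 0 ≤ ν * (β * (r + t + 2) + 2 * ((1 - β) * p) * (r + t + 1))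
      + μ * (β / 2 * ((t - r - 1) ^ 2 + (r - t - 1) ^ 2) + (1 - β) * p) := by positivity
    linarith
  · simp [inv_append, winv_append, inv, winv, -one_div, -mul_inv_rev] at hw ⊢
    generalize (A.count false : ℝ) = r at *
    generalize (B.count true : ℝ) = t at *
    generalize (inv A : ℝ) = f at *
    generalize (inv B : ℝ) = g at *
    generalize (winv A : ℝ) = u at *
    generalize (winv B : ℝ) = v at *
    have hd := hdrift (by nlinarith)
    generalize 3 / (2 * s) = ν at *
    generalize 1 / (8 * s ^ 2) = μ at *
    have h1 : 0 ≤ ν * (β * (r + t + 2) + 2 * ((1 - β) * p) * (r + t + 1)) := by positivity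
    have h2 : 0 ≤ μ * ((1 - β) * (1 - p)) := by positivity
    linarith

lemma stepMean_ge {β p e c : ℝ} {h : Word → ℝ} {w : Word} (hc : 0 ≤ c)
    (hβp : 0 ≤ (1 - β) * (1 - 2 * p) - β)
    (hh : ∀ i ∈ unlikeSet w, h w + c *
        (if (pad w).getD i true then (1 - β) * (1 - p) else -((1 - β) * p + β))
      - e ≤ pairMean β p h w i) : h w - e ≤ stepMean β p h w := by
  have hn : (0 : ℝ) < (unlikeSet w).card := by exact_mod_cast card_unlikeSet_pos w
  have hsum := Finset.sum_le_sum hh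
  have hsign : ∑ i ∈ unlikeSet w,
      (if (pad w).getD i true then (1 - β) * (1 - p) else -((1 - β) * p + β))
      = ((1 - β) + β) / 2 + (unlikeSet w).card * (((1 - β) * (1 - 2 * p) - β) / 2) := by
    have h1 : ∀ i ∈ unlikeSet w,
        (if (pad w).getD i true then (1 - β) * (1 - p) else -((1 - β) * p + β))
        = 1 / 2 * (if (pad w).getD i true then (1 : ℝ) else -1)
          + ((1 - β) * (1 - 2 * p) - β) / 2 := by
      intro i _
      split_ifs <;> ring
    rw [Finset.sum_congr rfl h1, Finset.sum_add_distrib, ← Finset.mul_sum, sum_sign]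
    simp
  rw [Finset.sum_sub_distrib, Finset.sum_add_distrib, ← Finset.mul_sum, hsign] at hsum
  simp only [Finset.sum_const, nsmul_eq_mul] at hsum
  rw [stepMean, inv_mul_eq_div, le_div_iff₀ hn]
  have : 0 ≤ c * (((1 - β) + β) / 2
      + (unlikeSet w).card * (((1 - β) * (1 - 2 * p) - β) / 2)) := by
    refine mul_nonneg hc (add_nonneg (by linarith) (by positivity))
  linarith

lemma stepMean_lyap_ge {β p s : ℝ} (hβ0 : 0 < β) (hβ1 : β ≤ 1) (hp0 : 0 ≤ p) (hp1 : p ≤ 1)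
    (hβp : 0 ≤ (1 - β) * (1 - 2 * p) - β) (hs : 1 ≤ s) {w : Word}
    (hw : (inv w : ℝ) < 4 * s ^ 2) :
    lyap s w - lyapLoss β s w.length ≤ stepMean β p (lyap s) w :=
  stepMean_ge (c := 1 + 1 / (4 * s ^ 2) * inv w) (by positivity) hβp
    fun _ hi => pairMean_lyap_ge hβ0 hβ1 hp0 hp1 hs hw hi

/-- Just above the level `4 * s ^ 2` the Lyapunov function is nonpositive. -/
lemma lyap_nonpos {s : ℕ} (hs : 0 < s) {w : Word} (h1 : 4 * (s : ℝ) ^ 2 ≤ inv w)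
    (h2 : (inv w : ℝ) ≤ 8 * (s : ℝ) ^ 2) : lyap s w ≤ 0 := by
  have hs0 : (0 : ℝ) < s := by exact_mod_cast hs
  have h : 2 * (s : ℝ) * inv w ≤ winv w + 2 * (s : ℝ) ^ 3 := by
    exact_mod_cast two_mul_inv_le w s
  have h3 : 3 / (2 * s) * (2 * (s : ℝ) * inv w - 2 * (s : ℝ) ^ 3) ≤ 3 / (2 * s) * winv w := by
    gcongr
    linarith
  have h4 : 3 / (2 * s) * (2 * (s : ℝ) * inv w - 2 * (s : ℝ) ^ 3)
      = 3 * inv w - 3 * (s : ℝ) ^ 2 := by field_simp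
  have h5 : 1 / (8 * (s : ℝ) ^ 2) * (inv w : ℝ) ^ 2 ≤ inv w := by
    rw [one_div, inv_mul_le_iff₀ (by positivity)]
    nlinarith
  unfold lyap
  nlinarith

lemma lyap_le {s : ℝ} (hs : 1 ≤ s) {w : Word} (hw : (inv w : ℝ) < 4 * s ^ 2) :
    lyap s w ≤ 6 * s ^ 2 := by
  have h1 : 1 / (8 * s ^ 2) * (inv w : ℝ) ^ 2 ≤ 2 * s ^ 2 := by
    rw [one_div, inv_mul_le_iff₀ (by positivity)]
    nlinarith [(inv w).cast_nonneg (α := ℝ)]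
  have h2 : 0 ≤ 3 / (2 * s) * winv w := by positivity
  unfold lyap
  linarith

lemma inv_swapPair {w : Word} {i : ℕ} (hi : i ∈ unlikeSet w) :
    (inv (swapPair (pad w) i) : ℝ) = inv w + (if (pad w).getD i true then 1 else -1) := by
  obtain ⟨A, B, a, hpad, ha, -, -, hswap⟩ := exists_split hi
  rw [ha, hswap, ← inv_pad w, hpad]
  cases a <;> simp [inv_append, inv] <;> ring

lemma stepMean_min_ge {p : ℝ} (hp0 : 0 ≤ p) (hp : p ≤ 1 / 2) (s : ℕ) (w : Word) :
    min (inv w : ℝ) s - (if (s : ℝ) ≤ (w.length : ℝ) ^ 2 then 1 else 0)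
      ≤ stepMean 0 p (fun v => min (inv v : ℝ) s) w := by
  rcases lt_or_ge (inv w) s with hlt | hge
  · refine stepMean_ge (h := fun v => min (inv v : ℝ) s) zero_le_one (by linarith)
      fun i hi => ?_
    have hs : (inv w : ℝ) + 1 ≤ s := by exact_mod_cast hlt
    have he : (0 : ℝ) ≤ if (s : ℝ) ≤ (w.length : ℝ) ^ 2 then 1 else 0 := by positivity
    simp only [pairMean, inv_strip, inv_swapPair hi]
    have hm : min ((inv w : ℝ) + if (pad w).getD i true then 1 else -1) s
        = inv w + if (pad w).getD i true then 1 else -1 :=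
      min_eq_left (by split_ifs <;> linarith)
    rw [min_eq_left (by linarith : (inv w : ℝ) ≤ s), hm]
    split_ifs at he ⊢ <;> linarith
  · have hs : (s : ℝ) ≤ inv w := by exact_mod_cast hge
    have hl : (inv w : ℝ) ≤ (w.length : ℝ) ^ 2 := by exact_mod_cast inv_le_length_sq w
    rw [if_pos (hs.trans hl)]
    refine stepMean_ge (h := fun v => min (inv v : ℝ) s) le_rfl (by linarith) fun i hi => ?_
    simp only [pairMean, inv_strip, inv_swapPair hi]
    rw [min_eq_right hs]
    have h1 : (s : ℝ) - 1 ≤ min ((inv w : ℝ) + if (pad w).getD i true then 1 else -1) s :=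
      le_min (by split_ifs <;> linarith) (by linarith)
    generalize min ((inv w : ℝ) + if (pad w).getD i true then 1 else -1) s = m at *
    split_ifs <;> nlinarith

/-- The words of length at most `n`. -/
noncomputable def wordsUpTo (n : ℕ) : Finset Word := (List.finite_length_le Bool n).toFinset

lemma mem_wordsUpTo {n : ℕ} {w : Word} : w ∈ wordsUpTo n ↔ w.length ≤ n := by
  simp [wordsUpTo]

/-- The probability that the chain started at `S` stays in `G` up to time `t` and is then
at a given word. -/
noncomputable def stayProb (β p : ℝ) (G : Set Word) (S : Word) : ℕ → Word → ℝ
  | 0 => fun w => if w = S then 1 else 0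
  | t + 1 => G.indicator fun w' =>
      ∑ w ∈ wordsUpTo (S.length + 2 * t), stayProb β p G S t w * P β p w w'

lemma stayProb_nonneg {β p : ℝ} (hP : ∀ w w', 0 ≤ P β p w w') (G : Set Word) (S : Word) (t : ℕ)
    (w : Word) : 0 ≤ stayProb β p G S t w := by
  induction t generalizing w with
  | zero => simp only [stayProb]; positivity
  | succ t ih =>
    exact Set.indicator_nonneg
      (fun _ _ => Finset.sum_nonneg fun v _ => mul_nonneg (ih v) (hP _ _)) _

lemma mem_of_stayProb_ne_zero {β p : ℝ} {G : Set Word} {S : Word} (hS : S ∈ G) {t : ℕ} {w : Word}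
    (h : stayProb β p G S t w ≠ 0) : w ∈ G := by
  cases t with
  | zero =>
    by_contra hw
    refine h (if_neg ?_)
    rintro rfl
    exact hw hS
  | succ t => exact Set.mem_of_indicator_ne_zero h

/-- The probability that the chain started at `S` stays in `G` up to time `t`. -/
noncomputable def stayMass (β p : ℝ) (G : Set Word) (S : Word) (t : ℕ) : ℝ :=
  ∑ w ∈ wordsUpTo (S.length + 2 * t), stayProb β p G S t w

lemma stay_step {β p : ℝ} (hP : ∀ w w', 0 ≤ P β p w w') {G : Set Word} {S : Word} (hS : S ∈ G)
    {H : Word → ℝ} {t : ℕ} {e : ℝ}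
    (hstep : ∀ w ∈ G, w.length ≤ S.length + 2 * t → H w - e ≤ stepMean β p H w)
    (hexit : ∀ w ∈ G, ∀ w' ∉ G, P β p w w' ≠ 0 → H w' ≤ 0) :
    ∑ w ∈ wordsUpTo (S.length + 2 * t), stayProb β p G S t w * H w - e * stayMass β p G S t
      ≤ ∑ w ∈ wordsUpTo (S.length + 2 * (t + 1)), stayProb β p G S (t + 1) w * H w := by
  have h1 : ∑ w ∈ wordsUpTo (S.length + 2 * t), stayProb β p G S t w * (H w - e)
      ≤ ∑ w ∈ wordsUpTo (S.length + 2 * t), stayProb β p G S t w *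
        ∑ w' ∈ wordsUpTo (S.length + 2 * (t + 1)), P β p w w' * H w' := by
    refine Finset.sum_le_sum fun w hw => ?_
    rw [mem_wordsUpTo] at hw
    rw [sum_P_mul _ _ _ _ _ fun v hv => mem_wordsUpTo.mpr (by omega)]
    by_cases h0 : stayProb β p G S t w = 0
    · simp [h0]
    · exact mul_le_mul_of_nonneg_left (hstep w (mem_of_stayProb_ne_zero hS h0) hw)
        (stayProb_nonneg hP ..)
  have h2 : ∑ w ∈ wordsUpTo (S.length + 2 * t), stayProb β p G S t w * (H w - e)
      = ∑ w ∈ wordsUpTo (S.length + 2 * t), stayProb β p G S t w * H w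
        - e * stayMass β p G S t := by
    rw [stayMass, Finset.mul_sum, ← Finset.sum_sub_distrib]
    exact Finset.sum_congr rfl fun _ _ => by ring
  rw [← h2]
  refine h1.trans ?_
  simp only [Finset.mul_sum]
  rw [Finset.sum_comm]
  refine Finset.sum_le_sum fun w' _ => ?_
  by_cases hw' : w' ∈ G
  · simp only [stayProb, Set.indicator_of_mem hw', Finset.sum_mul, mul_assoc, le_refl]
  · simp only [stayProb, Set.indicator_of_notMem hw', zero_mul]
    refine Finset.sum_nonpos fun w _ => ?_
    by_cases h0 : stayProb β p G S t w = 0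
    · simp [h0]
    by_cases h3 : P β p w w' = 0
    · simp [h3]
    · exact mul_nonpos_of_nonneg_of_nonpos (stayProb_nonneg hP ..)
        (mul_nonpos_of_nonneg_of_nonpos (hP _ _)
          (hexit w (mem_of_stayProb_ne_zero hS h0) w' hw' h3))

lemma le_stayMass {β p : ℝ} (hP : ∀ w w', 0 ≤ P β p w w') {G : Set Word} {S : Word} (hS : S ∈ G)
    {H : Word → ℝ} {e : ℕ → ℝ} {C : ℝ} (hC : ∀ w ∈ G, H w ≤ C)
    (hstep : ∀ t, ∀ w ∈ G, w.length ≤ S.length + 2 * t → H w - e t ≤ stepMean β p H w)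
    (hexit : ∀ w ∈ G, ∀ w' ∉ G, P β p w w' ≠ 0 → H w' ≤ 0) (t : ℕ) :
    H S ≤ C * stayMass β p G S t + ∑ u ∈ Finset.range t, e u * stayMass β p G S u := by
  have h1 : H S ≤ ∑ w ∈ wordsUpTo (S.length + 2 * t), stayProb β p G S t w * H w
      + ∑ u ∈ Finset.range t, e u * stayMass β p G S u := by
    induction t with
    | zero => simp [stayProb, mem_wordsUpTo]
    | succ t ih =>
      have := stay_step hP hS (hstep t) hexit
      rw [Finset.sum_range_succ]
      linarith
  have h2 : ∑ w ∈ wordsUpTo (S.length + 2 * t), stayProb β p G S t w * H w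
      ≤ C * stayMass β p G S t := by
    rw [stayMass, Finset.mul_sum]
    refine Finset.sum_le_sum fun w _ => ?_
    by_cases h0 : stayProb β p G S t w = 0
    · simp [h0]
    · rw [mul_comm C]
      exact mul_le_mul_of_nonneg_left (hC w (mem_of_stayProb_ne_zero hS h0))
        (stayProb_nonneg hP ..)
  linarith

/-- The Markov property of the chain for events determined by the path. -/
lemma IsEVChain.measure_stay {β p : ℝ} {Ω : Type*} [MeasurableSpace Ω] {μ : Measure Ω}
    {ξ : ℕ → Ω → Word} (h : IsEVChain β p μ ξ) (G : Set Word) (t : ℕ) (w w' : Word) :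
    μ ({ω | (∀ i ≤ t, ξ i ω ∈ G) ∧ ξ t ω = w} ∩ {ω | ξ (t + 1) ω = w'})
      = μ {ω | (∀ i ≤ t, ξ i ω ∈ G) ∧ ξ t ω = w} * ENNReal.ofReal (P β p w w') := by
  obtain ⟨hm, hP⟩ := h
  let f : Ω → Fin (t + 1) → Word := fun ω i => ξ i ω
  have hf : Measurable f := measurable_pi_lambda _ fun i => hm i
  let Q : Set (Fin (t + 1) → Word) := {q | (∀ i, q i ∈ G) ∧ q (Fin.last t) = w}
  have hQ : {ω | (∀ i ≤ t, ξ i ω ∈ G) ∧ ξ t ω = w} = f ⁻¹' Q := by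
    ext ω
    simp only [Set.mem_ofPred_eq, Set.mem_preimage, Q, f, Fin.val_last]
    refine and_congr ⟨fun h i => h i (by omega), fun h i hi => h ⟨i, by omega⟩⟩ Iff.rfl
  have hs : MeasurableSet {ω | ξ (t + 1) ω = w'} := hm (t + 1) (MeasurableSet.of_discrete (s := {w'}))
  have hfs : ∀ q, MeasurableSet (f ⁻¹' {q}) := fun q => hf (measurableSet_singleton q)
  rw [hQ, ← Measure.restrict_apply' hs,
    ← tsum_measure_preimage_singleton (Set.to_countable Q) fun q _ => hfs q,
    ← tsum_measure_preimage_singleton (Set.to_countable Q) fun q _ => hfs q,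
    ← ENNReal.tsum_mul_right]
  refine tsum_congr fun ⟨q, hq⟩ => ?_
  let path : ℕ → Word := fun i => if hi : i < t + 1 then q ⟨i, hi⟩ else w'
  have h1 : f ⁻¹' {q} = {ω | ∀ i ≤ t, ξ i ω = path i} := by
    ext ω
    simp only [Set.mem_preimage, Set.mem_singleton_iff, Set.mem_ofPred_eq, funext_iff, f]
    refine ⟨fun h i hi => ?_, fun h i => ?_⟩
    · simpa [path, hi] using h ⟨i, by omega⟩
    · have := h i (by omega)
      simpa [path, Nat.le_of_lt_succ i.2] using this
  have h2 : f ⁻¹' {q} ∩ {ω | ξ (t + 1) ω = w'} = {ω | ∀ i ≤ t + 1, ξ i ω = path i} := by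
    rw [h1]
    ext ω
    simp only [Set.mem_inter_iff, Set.mem_ofPred_eq]
    refine ⟨fun h i hi => ?_, fun h => ⟨fun i hi => h i (by omega), ?_⟩⟩
    · rcases Nat.lt_or_ge i (t + 1) with h' | h'
      · exact h.1 i (by omega)
      · obtain rfl : i = t + 1 := by omega
        simpa [path] using h.2
    · simpa [path] using h (t + 1) le_rfl
  have h3 : path t = w := by simpa [path, Fin.last] using hq.2
  have h4 : path (t + 1) = w' := by simp [path]
  rw [Measure.restrict_apply' hs, h2, hP, h1, h3, h4]

lemma IsEVChain.stayMass_le {β p : ℝ} {Ω : Type*} [MeasurableSpace Ω] {μ : Measure Ω}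
    [IsProbabilityMeasure μ] {ξ : ℕ → Ω → Word} (h : IsEVChain β p μ ξ)
    (hP : ∀ w w', 0 ≤ P β p w w') {G : Set Word} {S : Word} (hS : S ∈ G)
    (hinit : ∀ᵐ ω ∂μ, ξ 0 ω = S) (t : ℕ) :
    stayMass β p G S t ≤ μ.real {ω | ∀ i ≤ t, ξ i ω ∈ G} := by
  have hmem : ∀ (t : ℕ) (B : Set Word), MeasurableSet {ω | ξ t ω ∈ B} :=
    fun t B => h.1 t MeasurableSet.of_discrete
  have hstay : ∀ t, MeasurableSet {ω | ∀ i ≤ t, ξ i ω ∈ G} := fun t => by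
    simp only [Set.ofPred_forall]
    exact MeasurableSet.iInter fun i => MeasurableSet.iInter fun _ => hmem i G
  have hat : ∀ t w, MeasurableSet {ω | (∀ i ≤ t, ξ i ω ∈ G) ∧ ξ t ω = w} := fun t w =>
    (hstay t).inter (hmem t {w})
  have key : ∀ w, stayProb β p G S t w ≤ μ.real {ω | (∀ i ≤ t, ξ i ω ∈ G) ∧ ξ t ω = w} := by
    induction t with
    | zero =>
      intro w
      simp only [stayProb]
      split_ifs with hw
      · have : ∀ᵐ ω ∂μ, ω ∈ {ω | (∀ i ≤ 0, ξ i ω ∈ G) ∧ ξ 0 ω = w} := by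
          filter_upwards [hinit] with ω hω
          simp [hω, hw, hS]
        rw [measureReal_def, (mem_ae_iff_prob_eq_one (hat 0 w)).mp this, ENNReal.toReal_one]
      · exact measureReal_nonneg
    | succ t ih =>
      intro w'
      by_cases hw' : w' ∈ G
      · simp only [stayProb, Set.indicator_of_mem hw']
        calc _ ≤ ∑ w ∈ wordsUpTo (S.length + 2 * t),
              μ.real {ω | (∀ i ≤ t, ξ i ω ∈ G) ∧ ξ t ω = w} * P β p w w' :=
              Finset.sum_le_sum fun w _ => mul_le_mul_of_nonneg_right (ih w) (hP _ _)
          _ = ∑ w ∈ wordsUpTo (S.length + 2 * t),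
              μ.real ({ω | (∀ i ≤ t, ξ i ω ∈ G) ∧ ξ t ω = w} ∩ {ω | ξ (t + 1) ω = w'}) := by
              refine Finset.sum_congr rfl fun w _ => ?_
              rw [measureReal_def, measureReal_def, h.measure_stay, ENNReal.toReal_mul,
                ENNReal.toReal_ofReal (hP _ _)]
          _ = μ.real (⋃ w ∈ wordsUpTo (S.length + 2 * t),
              {ω | (∀ i ≤ t, ξ i ω ∈ G) ∧ ξ t ω = w} ∩ {ω | ξ (t + 1) ω = w'}) := by
              refine (measureReal_biUnion_finset ?_
                fun w _ => (hat t w).inter (hmem (t + 1) {w'})).symm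
              intro w _ v _ hwv
              refine Set.disjoint_left.mpr fun ω hω hω' => hwv ?_
              exact hω.1.2.symm.trans hω'.1.2
          _ ≤ _ := by
              refine measureReal_mono ?_
              simp only [Set.iUnion_subset_iff]
              rintro w _ ω ⟨⟨h1, -⟩, h2⟩
              refine ⟨fun i hi => ?_, h2⟩
              rcases Nat.lt_or_ge i (t + 1) with h' | h'
              · exact h1 i (by omega)
              · obtain rfl : i = t + 1 := by omega
                have h3 : ξ (t + 1) ω = w' := h2
                rwa [h3]
      · simp only [stayProb, Set.indicator_of_notMem hw']
        exact measureReal_nonneg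
  calc _ ≤ ∑ w ∈ wordsUpTo (S.length + 2 * t),
        μ.real {ω | (∀ i ≤ t, ξ i ω ∈ G) ∧ ξ t ω = w} := Finset.sum_le_sum fun w _ => key w
    _ = μ.real (⋃ w ∈ wordsUpTo (S.length + 2 * t),
        {ω | (∀ i ≤ t, ξ i ω ∈ G) ∧ ξ t ω = w}) := by
        refine (measureReal_biUnion_finset ?_ fun w _ => hat t w).symm
        intro w _ v _ hwv
        exact Set.disjoint_left.mpr fun ω hω hω' => hwv (hω.2.symm.trans hω'.2)
    _ ≤ _ := by
        refine measureReal_mono ?_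
        simp only [Set.iUnion_subset_iff]
        exact fun w _ ω hω => hω.1

/-- The relaxation time dominates the number of times before the ground state is reached. -/
lemma tsum_measure_le_lintegral_relaxTime {Ω : Type*} [MeasurableSpace Ω] (μ : Measure Ω)
    {ξ : ℕ → Ω → Word} (hξ : ∀ t, Measurable (ξ t)) :
    ∑' t, μ {ω | ∀ i ≤ t, ξ i ω ≠ groundState} ≤ ∫⁻ ω, relaxTime ξ ω ∂μ := by
  have hmeas : ∀ t, MeasurableSet {ω | ∀ i ≤ t, ξ i ω ≠ groundState} := fun t => by
    simp only [Set.ofPred_forall]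
    exact MeasurableSet.iInter fun i => MeasurableSet.iInter fun _ =>
      hξ i (MeasurableSet.of_discrete (s := {groundState}ᶜ))
  calc ∑' t, μ {ω | ∀ i ≤ t, ξ i ω ≠ groundState}
      = ∫⁻ ω, ∑' t, {ω | ∀ i ≤ t, ξ i ω ≠ groundState}.indicator 1 ω ∂μ := by
        rw [lintegral_tsum fun t => (measurable_one.indicator (hmeas t)).aemeasurable]
        exact tsum_congr fun t => (lintegral_indicator_one (hmeas t)).symm
    _ ≤ _ := by
        refine lintegral_mono fun ω => le_sInf ?_
        rintro r ⟨k, -, hk, rfl⟩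
        rw [tsum_eq_sum (s := Finset.range k)]
        · calc _ ≤ ∑ t ∈ Finset.range k, (1 : ℝ≥0∞) :=
                Finset.sum_le_sum fun t _ => Set.indicator_le_self' (fun _ _ => zero_le) ω
            _ = k := by simp
        · intro t ht
          have hkt : k ≤ t := by simpa using ht
          exact Set.indicator_of_notMem (fun h : ∀ i ≤ t, ξ i ω ≠ groundState => h k hkt hk) _

lemma relaxTime_le_rpow {Ω : Type*} (ξ : ℕ → Ω → Word) {q : ℝ} (hq : 1 ≤ q) (ω : Ω) :
    relaxTime ξ ω ≤ relaxTime ξ ω ^ q := by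
  have h1 : 1 ≤ relaxTime ξ ω := by
    refine le_sInf ?_
    rintro r ⟨k, hk, -, rfl⟩
    exact_mod_cast hk
  simpa using ENNReal.rpow_le_rpow_of_exponent_le h1 hq

/-- A summable sequence cannot satisfy Lyapunov bounds whose losses vanish. -/
lemma not_eventually_le_of_summable {A : ℕ → ℝ} (hA0 : ∀ t, 0 ≤ A t) (hA : Summable A)
    {e : ℕ → ℕ → ℝ} {K : ℝ} (he0 : ∀ᶠ s in atTop, ∀ u, 0 ≤ e s u)
    (heK : ∀ᶠ s in atTop, ∀ u, e s u ≤ K)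
    (he : ∀ u, Tendsto (e · u) atTop (nhds 0)) {C : ℕ → ℝ} {c : ℝ} (hc : 0 < c) :
    ¬ ∀ᶠ s in atTop, ∀ t, c ≤ C s * A t + ∑ u ∈ Finset.range t, e s u * A u := by
  intro h
  have hlim : Tendsto (fun s => ∑' u, e s u * A u) atTop (nhds (∑' _ : ℕ, (0 : ℝ))) := by
    refine tendsto_tsum_of_dominated_convergence (bound := fun u => K * A u) (hA.mul_left K)
      (fun u => by simpa using (he u).mul_const (A u)) ?_
    filter_upwards [he0, heK] with s h0 hK u
    rw [Real.norm_of_nonneg (mul_nonneg (h0 u) (hA0 u))]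
    exact mul_le_mul_of_nonneg_right (hK u) (hA0 u)
  rw [tsum_zero] at hlim
  have hle : ∀ᶠ s in atTop, c ≤ ∑' u, e s u * A u := by
    filter_upwards [h, he0, heK] with s hs h0 hK
    have hsum : Summable fun u => e s u * A u :=
      (hA.mul_left K).of_nonneg_of_le (fun u => mul_nonneg (h0 u) (hA0 u))
        fun u => mul_le_mul_of_nonneg_right (hK u) (hA0 u)
    have hl := (hA.tendsto_atTop_zero.const_mul (C s)).add hsum.hasSum.tendsto_sum_nat
    rw [mul_zero, zero_add] at hl
    exact ge_of_tendsto' hl hs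
  exact hc.not_ge (ge_of_tendsto hlim hle)

lemma lintegral_relaxTime_eq_top {β p : ℝ} {Ω : Type*} [MeasurableSpace Ω] {μ : Measure Ω}
    [IsProbabilityMeasure μ] {ξ : ℕ → Ω → Word} (h : IsEVChain β p μ ξ)
    (hP : ∀ w w', 0 ≤ P β p w w') {S : Word} (hinit : ∀ᵐ ω ∂μ, ξ 0 ω = S)
    {H : ℕ → Word → ℝ} {G : ℕ → Set Word} {C : ℕ → ℝ} {e : ℕ → ℕ → ℝ} {c K : ℝ} (hc : 0 < c)
    (he0 : ∀ᶠ s in atTop, ∀ u, 0 ≤ e s u) (heK : ∀ᶠ s in atTop, ∀ u, e s u ≤ K)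
    (he : ∀ u, Tendsto (e · u) atTop (nhds 0))
    (hC0 : ∀ᶠ s in atTop, 0 ≤ C s)
    (hS : ∀ᶠ s in atTop, S ∈ G s) (hcS : ∀ᶠ s in atTop, c ≤ H s S)
    (hne : ∀ s, groundState ∉ G s)
    (hC : ∀ᶠ s in atTop, ∀ w ∈ G s, H s w ≤ C s)
    (hstep : ∀ᶠ s in atTop, ∀ t, ∀ w ∈ G s, w.length ≤ S.length + 2 * t →
      H s w - e s t ≤ stepMean β p (H s) w)
    (hexit : ∀ᶠ s in atTop, ∀ w ∈ G s, ∀ w' ∉ G s, P β p w w' ≠ 0 → H s w' ≤ 0) :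
    ∫⁻ ω, relaxTime ξ ω ∂μ = ⊤ := by
  by_contra htop
  set A : ℕ → ℝ := fun t => μ.real {ω | ∀ i ≤ t, ξ i ω ≠ groundState}
  have hA : Summable A :=
    ENNReal.summable_toReal (ne_top_of_le_ne_top htop (tsum_measure_le_lintegral_relaxTime μ h.1))
  refine not_eventually_le_of_summable (A := A) (C := C) (fun t => measureReal_nonneg) hA he0 heK
    he hc ?_
  filter_upwards [he0, hC0, hS, hcS, hC, hstep, hexit] with s he0 hC0 hS hcS hC hstep hexit t
  have hmass : ∀ u, stayMass β p (G s) S u ≤ A u := fun u =>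
    (h.stayMass_le hP hS hinit u).trans <| measureReal_mono fun ω hω i hi h0 =>
      hne s (h0 ▸ hω i hi)
  refine (hcS.trans (le_stayMass hP hS hC hstep hexit t)).trans (add_le_add ?_ ?_)
  · exact mul_le_mul_of_nonneg_left (hmass t) hC0
  · exact Finset.sum_le_sum fun u _ => mul_le_mul_of_nonneg_left (hmass u) (he0 u)

lemma lintegral_relaxTime_eq_top_of_beta_eq_zero {p : ℝ} (hp0 : 0 ≤ p) (hp : p ≤ 1 / 2)
    {S : Word} (hS : IsConfig S) (hne : S ≠ groundState)
    {Ω : Type*} [MeasurableSpace Ω] {μ : Measure Ω} [IsProbabilityMeasure μ]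
    {ξ : ℕ → Ω → Word} (h : IsEVChain 0 p μ ξ) (hinit : ∀ᵐ ω ∂μ, ξ 0 ω = S) :
    ∫⁻ ω, relaxTime ξ ω ∂μ = ⊤ := by
  have hpos : (1 : ℝ) ≤ inv S := by exact_mod_cast inv_pos hS hne
  refine lintegral_relaxTime_eq_top h (P_nonneg le_rfl zero_le_one hp0 (by linarith)) hinit
    (H := fun s v => min (inv v : ℝ) s) (G := fun _ => {groundState}ᶜ) (C := fun s => s)
    (e := fun s u => if (s : ℝ) ≤ ((S.length + 2 * u : ℕ) : ℝ) ^ 2 then 1 else 0)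
    (c := 1) (K := 1) one_pos ?_ ?_ ?_ ?_ ?_ ?_ ?_ ?_ ?_ ?_
  · exact .of_forall fun s u => by positivity
  · exact .of_forall fun s u => by split_ifs <;> norm_num
  · intro u
    refine tendsto_const_nhds.congr' ?_
    filter_upwards [eventually_gt_atTop ((S.length + 2 * u) ^ 2)] with s hs
    rw [if_neg]
    exact_mod_cast hs.not_ge
  · exact .of_forall fun s => by positivity
  · exact .of_forall fun s => hne
  · filter_upwards [eventually_ge_atTop 1] with s hs
    exact le_min hpos (by exact_mod_cast hs)
  · exact fun s hs => hs rfl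
  · exact .of_forall fun s w _ => min_le_right _ _
  · refine .of_forall fun s t w _ hw => le_trans ?_ (stepMean_min_ge hp0 hp s w)
    have hl : (w.length : ℝ) ^ 2 ≤ ((S.length + 2 * t : ℕ) : ℝ) ^ 2 := by gcongr
    refine sub_le_sub_left ?_ _
    split_ifs with h1 h2
    · exact le_rfl
    · exact absurd (h1.trans hl) h2
    · exact zero_le_one
    · exact le_rfl
  · refine .of_forall fun s w _ w' hw' _ => ?_
    obtain rfl : w' = [] := by simpa [groundState] using hw'
    simp [inv]

lemma lintegral_relaxTime_eq_top_of_beta_pos {β p : ℝ} (hβ0 : 0 < β) (hβ1 : β ≤ 1)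
    (hp0 : 0 ≤ p) (hp1 : p ≤ 1) (hβp : 0 ≤ (1 - β) * (1 - 2 * p) - β)
    {S : Word} (hS : IsConfig S) (hne : S ≠ groundState)
    {Ω : Type*} [MeasurableSpace Ω] {μ : Measure Ω} [IsProbabilityMeasure μ]
    {ξ : ℕ → Ω → Word} (h : IsEVChain β p μ ξ) (hinit : ∀ᵐ ω ∂μ, ξ 0 ω = S) :
    ∫⁻ ω, relaxTime ξ ω ∂μ = ⊤ := by
  have hpos : (1 : ℝ) ≤ inv S := by exact_mod_cast inv_pos hS hne
  have hs1 : ∀ᶠ s : ℕ in atTop, 1 ≤ s := eventually_ge_atTop 1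
  have hdiv : ∀ a : ℝ, Tendsto (fun s : ℕ => a / s) atTop (nhds 0) :=
    tendsto_const_div_atTop_nhds_zero_nat
  refine lintegral_relaxTime_eq_top h (P_nonneg hβ0.le hβ1 hp0 hp1) hinit
    (H := fun s => lyap s)
    (G := fun s => {w | w ≠ groundState ∧ (inv w : ℝ) < 4 * (s : ℝ) ^ 2})
    (C := fun s => 6 * (s : ℝ) ^ 2) (e := fun s u => lyapLoss β s (S.length + 2 * u))
    (c := 1 / 2) (K := 8 + 18 / β) (by norm_num) ?_ ?_ ?_ ?_ ?_ ?_ ?_ ?_ ?_ ?_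
  · filter_upwards [hs1] with s hs u
    exact lyapLoss_nonneg hβ0 (by exact_mod_cast hs) _
  · exact .of_forall fun s u => min_le_right _ _
  · intro u
    refine squeeze_zero' (g := fun s : ℕ => 3 / (s : ℝ) * ((S.length + 2 * u : ℕ) + 2)) ?_ ?_ ?_
    · filter_upwards [hs1] with s hs
      exact lyapLoss_nonneg hβ0 (by exact_mod_cast hs) _
    · exact .of_forall fun s => min_le_left _ _
    · simpa using (hdiv 3).mul_const (((S.length + 2 * u : ℕ) : ℝ) + 2)
  · exact .of_forall fun s => by positivity
  · filter_upwards [eventually_gt_atTop (inv S)] with s hs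
    have hs' : (inv S : ℝ) < s := by exact_mod_cast hs
    exact ⟨hne, by nlinarith⟩
  · filter_upwards [((hdiv (3 / 2 * winv S)).eventually (gt_mem_nhds one_half_pos))] with s hs
    have h1 : 3 / (2 * (s : ℝ)) * winv S = 3 / 2 * winv S / s := by ring
    have h2 : 0 ≤ 1 / (8 * (s : ℝ) ^ 2) * (inv S : ℝ) ^ 2 := by positivity
    rw [lyap, h1]
    linarith
  · exact fun s hs => hs.1 rfl
  · filter_upwards [hs1] with s hs w hw
    exact lyap_le (by exact_mod_cast hs) hw.2
  · filter_upwards [hs1] with s hs t w hw hl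
    have hs' : (1 : ℝ) ≤ s := by exact_mod_cast hs
    refine le_trans ?_ (stepMean_lyap_ge hβ0 hβ1 hp0 hp1 hβp hs' hw.2)
    refine sub_le_sub_left (min_le_min_right _ ?_) _
    gcongr
  · filter_upwards [hs1] with s hs w hw w' hw' hP
    by_cases h0 : w' = groundState
    · simp [h0, groundState, lyap, inv, winv]
    · have h1 : 4 * (s : ℝ) ^ 2 ≤ inv w' := not_lt.mp fun h1 => hw' ⟨h0, h1⟩
      refine lyap_nonpos hs h1 ?_
      have h2 : inv w < 4 * s ^ 2 := by exact_mod_cast hw.2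
      have h3 := inv_le_of_P_ne_zero hP
      have h4 : inv w' ≤ 8 * s ^ 2 := by omega
      exact_mod_cast h4

/-- Theorem 2: for `p < 1/2` and `β ≤ β₁(p) = (1-2p)/(2-2p)` (which lies in `(0, 1/2]`),
the relaxation time satisfies `E_{β,p}[τ^{1+ε} | ξ₀ = S₀] = ∞` for every `ε > 0` and
every `S₀ ∈ 𝒟 ∖ {𝒟₀}`. -/
theorem relaxTime_moment_one_plus_eps_infinite
    (p : ℝ) (hp0 : 0 ≤ p) (hp : p < 1 / 2)
    (β : ℝ) (hβ0 : 0 ≤ β) (hβ1 : β ≤ (1 - 2 * p) / (2 - 2 * p))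
    (ε : ℝ) (hε : 0 < ε)
    (S₀ : Word) (hS₀ : IsConfig S₀) (hS₀ne : S₀ ≠ groundState)
    {Ω : Type*} [MeasurableSpace Ω] (μ : Measure Ω) [IsProbabilityMeasure μ]
    (ξ : ℕ → Ω → Word) (hchain : IsEVChain β p μ ξ)
    (hinit : ∀ᵐ ω ∂μ, ξ 0 ω = S₀) :
    (0 < (1 - 2 * p) / (2 - 2 * p) ∧ (1 - 2 * p) / (2 - 2 * p) ≤ 1 / 2) ∧
    ∫⁻ ω, relaxTime ξ ω ^ (1 + ε) ∂μ = ⊤ := by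
  have hq : 0 < 2 - 2 * p := by linarith
  have hhalf : (1 - 2 * p) / (2 - 2 * p) ≤ 1 / 2 := by
    rw [div_le_iff₀ hq]
    linarith
  refine ⟨⟨div_pos (by linarith) hq, hhalf⟩, ?_⟩
  have hβp : 0 ≤ (1 - β) * (1 - 2 * p) - β := by
    rw [le_div_iff₀ hq] at hβ1
    linarith
  have hβle : β ≤ 1 := by linarith
  have htop : ∫⁻ ω, relaxTime ξ ω ∂μ = ⊤ := by
    rcases hβ0.eq_or_lt with rfl | hβ
    · exact lintegral_relaxTime_eq_top_of_beta_eq_zero hp0 hp.le hS₀ hS₀ne hchain hinit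
    · exact lintegral_relaxTime_eq_top_of_beta_pos hβ hβle hp0 (by linarith) hβp hS₀ hS₀ne
        hchain hinit
  exact top_le_iff.mp (htop ▸ lintegral_mono fun ω => relaxTime_le_rpow ξ (by linarith) ω)

end EV
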